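/- Let W be a round-fair token distribution process with k ≥ 2 tokens on a finite connected non-bipartite undirected graph G with m edges and diameter D. Then for every time T ≥ 16·m·D·ln k, the discrepancy over arcs of W_T is at most 10D. -/

import Mathlib

open Finset

namespace RotorRouter

variable {V : Type} [Fintype V] [DecidableEq V] (G : SimpleGraph V) [DecidableRel G.Adj]

/-- The outgoing arcs (darts) of a vertex `v`. -/
def outArcs (v : V) : Finset G.Dart := Finset.univ.filter (fun d => d.fst = v)

/-- The incoming arcs (darts) of a vertex `v`. -/
def inArcs (v : V) : Finset G.Dart := Finset.univ.filter (fun d => d.snd = v)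

/-- A state of the rotor-router system: at each vertex, the current pointer
(represented as an index, in the fixed cyclic order, of an outgoing arc) and the
number of tokens currently located at the vertex. -/
structure State where
  ptr : V → ℕ
  tokens : V → ℕ
  ptr_lt : ∀ v : V, 0 < G.degree v → ptr v < G.degree v

variable (ord : ∀ v : V, Fin (G.degree v) ≃ {d : G.Dart // d.fst = v})

/-- The number of tokens sent out on the `j`-th outgoing arc when `k` tokens leave a
vertex of degree `deg` in round-robin fashion, starting from pointer position `p`. -/
def sentCount (deg p k j : ℕ) : ℕ :=
  ((Finset.range k).filter (fun i => (p + i) % deg = j)).card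

/-- The number of tokens sent along the arc `d` during one step from state `S`. -/
def arcLoad (S : State G) (d : G.Dart) : ℕ :=
  sentCount (G.degree d.fst) (S.ptr d.fst) (S.tokens d.fst)
    (((ord d.fst).symm ⟨d, rfl⟩ : Fin (G.degree d.fst)) : ℕ)

/-- One synchronous step of the rotor-router system: every vertex sends out all of its
tokens in round-robin fashion, advancing its pointer after each token. -/
def step (S : State G) : State G where
  ptr v := if 0 < G.degree v then (S.ptr v + S.tokens v) % G.degree v else S.ptr v
  tokens v := (∑ d ∈ inArcs G v, arcLoad G ord S d) +
    (if 0 < G.degree v then 0 else S.tokens v)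
  ptr_lt v h := by simp only [if_pos h]; exact Nat.mod_lt _ h

/-- `evol S0 t` is the state `S_t` reached after `t` steps from the initial state `S0`. -/
def evol (S0 : State G) (t : ℕ) : State G := (step G ord)^[t] S0

/-- `load S0 t d` is `L_t(d)`, the number of tokens sent along arc `d` during step `t`. -/
def load (S0 : State G) (t : ℕ) (d : G.Dart) : ℕ := arcLoad G ord (evol G ord S0 t) d

/-- `cum S0 t1 t2 d` is the cumulative load `C_{t1}^{t2}(d) = Σ_{t1 ≤ t < t2} L_t(d)`. -/
def cum (S0 : State G) (t1 t2 : ℕ) (d : G.Dart) : ℕ :=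
  ∑ t ∈ Finset.Ico t1 t2, load G ord S0 t d

/-- `cumV S0 t1 t2 v` is the cumulative vertex load `C_{t1}^{t2}(v)`. -/
def cumV (S0 : State G) (t1 t2 : ℕ) (v : V) : ℕ :=
  ∑ t ∈ Finset.Ico t1 t2, (evol G ord S0 t).tokens v

/-- `pot S0 i t` is the `i`-th potential `Φ_i(S_t) = Σ_{e} (C_t^{t+i}(e))²`. -/
def pot (S0 : State G) (i t : ℕ) : ℕ := ∑ d : G.Dart, (cum G ord S0 t (t + i) d) ^ 2

/-- A state `S_t` is stable if it repeats: `S_{t'} = S_t` for some `t' > t`. -/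
def IsStable (S0 : State G) (t : ℕ) : Prop :=
  ∃ t' > t, evol G ord S0 t' = evol G ord S0 t

/-- A family of bijections `in(v) → out(v)` (encoded as a global bijection `M` on darts
with `(M d).fst = d.snd`) is valid w.r.t. the `Δt`-step subcycle decomposition of `S_T`
if `L_t(e) = L_{t+1}(M e)` for all arcs `e` and all `T ≤ t < T + Δt`. -/
def ValidMapping (S0 : State G) (T Δt : ℕ) (M : G.Dart → G.Dart) : Prop :=
  Function.Bijective M ∧ (∀ d : G.Dart, (M d).fst = d.snd) ∧
    ∀ (d : G.Dart) (t : ℕ), T ≤ t → t < T + Δt →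
      load G ord S0 t d = load G ord S0 (t + 1) (M d)

/-- `S_T` admits a `Δt`-step subcycle decomposition. -/
def HasSubcycleDecomp (S0 : State G) (T Δt : ℕ) : Prop :=
  ∃ M : G.Dart → G.Dart, ValidMapping G ord S0 T Δt M


/-- A round-fair token distribution process on `G`: loads `wv t v` on vertices and
`we t d` on arcs such that each vertex distributes its load almost evenly (floor or
ceiling of the average) among its outgoing arcs, sends out all of its load, and
receives in the next step the loads of its incoming arcs. -/
structure RoundFairProcess where
  wv : ℕ → V → ℕ
  we : ℕ → G.Dart → ℕ
  fair : ∀ (t : ℕ) (d : G.Dart),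
    we t d = wv t d.fst / G.degree d.fst ∨
      we t d = (wv t d.fst + G.degree d.fst - 1) / G.degree d.fst
  sum_out : ∀ (t : ℕ) (v : V), wv t v = ∑ d ∈ outArcs G v, we t d
  recv : ∀ (t : ℕ) (v : V), wv (t + 1) v = ∑ d ∈ inArcs G v, we t d

/-- The discrepancy over arcs of the process at time `t`:
`max_{e,e' ∈ E⃗} (W_t(e) − W_t(e'))`. -/
def disc (W : RoundFairProcess G) (t : ℕ) : ℕ :=
  Finset.univ.sup fun p : G.Dart × G.Dart => W.we t p.1 - W.we t p.2

/-- The potential `Φ(W_t) = Σ_{e ∈ E⃗} (W_t(e))²` of the process at time `t`. -/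
def rfPot (W : RoundFairProcess G) (t : ℕ) : ℕ := ∑ d : G.Dart, W.we t d ^ 2

/-- In a connected non-bipartite graph, any two vertices are joined by a walk of even length at
most twice the diameter. -/
theorem exists_even_walk {G : SimpleGraph V} (hconn : G.Connected) (hnb : ¬ G.Colorable 2)
    (u v : V) : ∃ l ≤ G.diam, ∃ p : G.Walk u v, p.length = 2 * l := by
  have := hconn.nonempty
  have hdiam : ∀ x y, G.dist x y ≤ G.diam := fun x y =>
    SimpleGraph.dist_le_diam (SimpleGraph.connected_iff_ediam_ne_top.mp hconn)
  by_contra! hno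
  have key : ∀ x y, G.Adj x y → (G.dist x v + G.dist y v) % 2 = 1 := by
    intro x y hxy
    obtain ⟨p, hp⟩ := hconn.exists_walk_length_eq_dist u x
    obtain ⟨q, hq⟩ := hconn.exists_walk_length_eq_dist x v
    obtain ⟨r, hr⟩ := hconn.exists_walk_length_eq_dist y v
    have h1 := hdiam u x
    have h2 := hdiam x v
    have h3 := hdiam y v
    have h4 := hno ((G.dist u x + G.dist x v) / 2) (by omega) (p.append q)
    have h5 := hno ((G.dist u x + (G.dist y v + 1)) / 2)
    have h6 : (p.append (SimpleGraph.Walk.cons hxy r)).length = _ :=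
      SimpleGraph.Walk.length_append _ _
    rw [SimpleGraph.Walk.length_append] at h4
    rw [SimpleGraph.Walk.length_cons] at h6
    by_contra hpar
    have h7 := h5 (by omega) (p.append (SimpleGraph.Walk.cons hxy r))
    omega
  refine hnb ⟨SimpleGraph.Coloring.mk
    (fun x => (⟨G.dist x v % 2, Nat.mod_lt _ two_pos⟩ : Fin 2)) ?_⟩
  intro x y hxy heq
  have := key x y hxy
  have := congrArg Fin.val heq
  simp only at this
  omega

/-- In a connected non-bipartite graph, any two vertices are joined by a vertex sequence of even
length at most twice the diameter, with consecutive vertices adjacent and pairwise distinct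
vertices at odd positions. -/
theorem exists_even_seq {G : SimpleGraph V} (hconn : G.Connected) (hnb : ¬ G.Colorable 2)
    (u v : V) : ∃ l ≤ G.diam, ∃ p : ℕ → V, p 0 = u ∧ p (2 * l) = v ∧
      (∀ i < 2 * l, G.Adj (p i) (p (i + 1))) ∧
      ∀ i < l, ∀ j < l, p (2 * i + 1) = p (2 * j + 1) → i = j := by
  classical
  let P : ℕ → Prop := fun l => ∃ p : ℕ → V, p 0 = u ∧ p (2 * l) = v ∧
    ∀ i < 2 * l, G.Adj (p i) (p (i + 1))
  obtain ⟨l₀, hl₀, w, hw⟩ := exists_even_walk hconn hnb u v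
  have hP₀ : P l₀ := by
    refine ⟨w.getVert, w.getVert_zero, ?_, fun i hi => w.adj_getVert_succ (hw ▸ hi)⟩
    rw [← hw, w.getVert_length]
  have hex : ∃ l, P l := ⟨l₀, hP₀⟩
  obtain ⟨p, hp0, hpl, hadj⟩ := Nat.find_spec hex
  set l := Nat.find hex
  have hne : ∀ i j, i < j → j < l → p (2 * i + 1) ≠ p (2 * j + 1) := by
    intro i j hij hj heq
    refine Nat.find_min hex (m := l - (j - i)) (by omega)
      ⟨fun n => if n ≤ 2 * i + 1 then p n else p (n + 2 * (j - i)), by simpa using hp0, ?_, ?_⟩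
    · simp only
      rw [if_neg (by omega), ← hpl]
      congr 1
      omega
    · intro n hn
      simp only
      rcases lt_trichotomy n (2 * i + 1) with h | h | h
      · rw [if_pos (by omega), if_pos (by omega)]
        exact hadj n (by omega)
      · rw [if_pos (by omega), if_neg (by omega), h, heq,
          show 2 * i + 1 + 1 + 2 * (j - i) = 2 * j + 1 + 1 by omega]
        exact hadj _ (by omega)
      · rw [if_neg (by omega), if_neg (by omega),
          show n + 1 + 2 * (j - i) = n + 2 * (j - i) + 1 by omega]
        exact hadj _ (by omega)
  refine ⟨l, (Nat.find_min' hex hP₀).trans hl₀, p, hp0, hpl, hadj, ?_⟩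
  intro i hi j hj heq
  rcases lt_trichotomy i j with h | h | h
  · exact absurd heq (hne i j h hj)
  · exact h
  · exact absurd heq.symm (hne j i h hi)

variable {G}

theorem card_outArcs (v : V) : (outArcs G v).card = G.degree v :=
  G.dart_fst_fiber_card_eq_degree v

theorem card_inArcs (v : V) : (inArcs G v).card = G.degree v := by
  rw [← card_outArcs]
  refine Finset.card_bij (fun d _ => d.symm) ?_ ?_ ?_
  · intro d hd
    simpa [inArcs, outArcs] using hd
  · intro d _ d' _ h
    exact SimpleGraph.Dart.symm_involutive.injective h
  · intro d hd
    exact ⟨d.symm, by simpa [inArcs, outArcs] using hd, d.symm_symm⟩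

theorem degree_fst_pos (d : G.Dart) : 0 < G.degree d.fst :=
  (G.degree_pos_iff_exists_adj _).mpr ⟨_, d.adj⟩

theorem sum_outArcs {M : Type*} [AddCommMonoid M] (f : G.Dart → M) :
    ∑ v, ∑ d ∈ outArcs G v, f d = ∑ d, f d :=
  Finset.sum_fiberwise _ _ _

theorem sum_inArcs {M : Type*} [AddCommMonoid M] (f : G.Dart → M) :
    ∑ v, ∑ d ∈ inArcs G v, f d = ∑ d, f d :=
  Finset.sum_fiberwise _ _ _

theorem one_le_diam_of_dart (hconn : G.Connected) (d : G.Dart) : 1 ≤ G.diam := by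
  have := hconn.nonempty
  rw [← SimpleGraph.dist_eq_one_iff_adj.mpr d.adj]
  exact SimpleGraph.dist_le_diam (SimpleGraph.connected_iff_ediam_ne_top.mp hconn)

theorem mul_sub_one_nonneg (n : ℤ) : 0 ≤ n * (n - 1) := by
  rcases le_or_gt n 0 with h | h <;> nlinarith

namespace RoundFairProcess

variable (W : RoundFairProcess G)

theorem we_eq_or (t : ℕ) (d : G.Dart) :
    W.we t d = W.wv t d.fst / G.degree d.fst ∨
      W.we t d = W.wv t d.fst / G.degree d.fst + 1 := by
  have hpos := degree_fst_pos d
  rcases W.fair t d with h | h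
  · exact Or.inl h
  · have h1 : W.wv t d.fst / G.degree d.fst ≤ W.we t d := by
      rw [h]
      exact Nat.div_le_div_right (by omega)
    have h2 : W.we t d ≤ W.wv t d.fst / G.degree d.fst + 1 := by
      rw [h, ← Nat.add_div_right _ hpos]
      exact Nat.div_le_div_right (by omega)
    omega

theorem sum_we_succ (t : ℕ) : ∑ d, W.we (t + 1) d = ∑ d, W.we t d := by
  rw [← sum_outArcs, ← sum_inArcs]
  exact Finset.sum_congr rfl fun v _ => by rw [← W.sum_out, W.recv]

theorem sum_we (t : ℕ) : ∑ d, W.we t d = ∑ d, W.we 0 d := by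
  induction t with
  | zero => rfl
  | succ t ih => rw [W.sum_we_succ, ih]

/-- Bounds on the arc loads are preserved over time. -/
theorem bounds_succ {t a b : ℕ} (h : ∀ d, a ≤ W.we t d ∧ W.we t d ≤ b) (d : G.Dart) :
    a ≤ W.we (t + 1) d ∧ W.we (t + 1) d ≤ b := by
  have hpos := degree_fst_pos d
  have hlo : a * G.degree d.fst ≤ W.wv (t + 1) d.fst := by
    rw [W.recv, ← card_inArcs, mul_comm, ← smul_eq_mul]
    exact Finset.card_nsmul_le_sum _ _ _ fun e _ => (h e).1
  have hhi : W.wv (t + 1) d.fst ≤ b * G.degree d.fst := by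
    rw [W.recv, ← card_inArcs, mul_comm, ← smul_eq_mul]
    exact Finset.sum_le_card_nsmul _ _ _ fun e _ => (h e).2
  have hfl : a ≤ W.wv (t + 1) d.fst / G.degree d.fst := (Nat.le_div_iff_mul_le hpos).mpr hlo
  have hcl : (W.wv (t + 1) d.fst + G.degree d.fst - 1) / G.degree d.fst ≤ b := by
    rw [← Nat.lt_succ_iff, Nat.div_lt_iff_lt_mul hpos, Nat.succ_mul]
    omega
  have hfc : W.wv (t + 1) d.fst / G.degree d.fst ≤
      (W.wv (t + 1) d.fst + G.degree d.fst - 1) / G.degree d.fst :=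
    Nat.div_le_div_right (by omega)
  rcases W.fair (t + 1) d with h' | h' <;> omega

theorem bounds_of_le {s t a b : ℕ} (hst : s ≤ t) (h : ∀ d, a ≤ W.we s d ∧ W.we s d ≤ b) :
    ∀ d, a ≤ W.we t d ∧ W.we t d ≤ b := by
  induction t, hst using Nat.le_induction with
  | base => exact h
  | succ n _ ih => exact W.bounds_succ ih

/-- The decrease of the sum of squares at the vertex `v` from time `t` to time `t + 1`. -/
def drop (t : ℕ) (v : V) : ℤ :=
  ∑ d ∈ inArcs G v, (W.we t d : ℤ) ^ 2 - ∑ d ∈ outArcs G v, (W.we (t + 1) d : ℤ) ^ 2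

theorem sum_drop (t : ℕ) : ∑ v, W.drop t v = rfPot G W t - rfPot G W (t + 1) := by
  simp only [drop, Finset.sum_sub_distrib, sum_inArcs, sum_outArcs, rfPot]
  push_cast
  rfl

theorem drop_eq (t : ℕ) (v : V) :
    W.drop t v = ∑ d ∈ inArcs G v,
      ((W.we t d : ℤ) - (W.wv (t + 1) v / G.degree v : ℕ)) *
        ((W.we t d : ℤ) - (W.wv (t + 1) v / G.degree v : ℕ) - 1) := by
  set q : ℤ := ((W.wv (t + 1) v / G.degree v : ℕ) : ℤ) with hq
  have hout : ∑ d ∈ outArcs G v,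
      ((W.we (t + 1) d : ℤ) - q) * ((W.we (t + 1) d : ℤ) - q - 1) = 0 := by
    refine Finset.sum_eq_zero fun d hd => ?_
    have hdv : d.fst = v := by simpa [outArcs] using hd
    subst hdv
    rcases W.we_eq_or (t + 1) d with h | h
    · rw [h, hq, sub_self, zero_mul]
    · rw [h, hq]
      push_cast
      ring
  have hexp : ∀ (s : ℕ) (A : Finset G.Dart),
      ∑ d ∈ A, ((W.we s d : ℤ) - q) * ((W.we s d : ℤ) - q - 1) =
        ∑ d ∈ A, (W.we s d : ℤ) ^ 2 - (2 * q + 1) * ((∑ d ∈ A, W.we s d : ℕ) : ℤ)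
          + A.card * (q * (q + 1)) := by
    intro s A
    push_cast
    rw [Finset.mul_sum, ← Finset.sum_sub_distrib, ← nsmul_eq_mul, ← Finset.sum_const,
      ← Finset.sum_add_distrib]
    exact Finset.sum_congr rfl fun d _ => by ring
  rw [hexp, card_outArcs, ← W.sum_out] at hout
  rw [hexp, card_inArcs, ← W.recv, drop]
  linarith

theorem drop_nonneg (t : ℕ) (v : V) : 0 ≤ W.drop t v := by
  rw [drop_eq]
  exact Finset.sum_nonneg fun d _ => mul_sub_one_nonneg _

/-- Two arcs with the same head and different loads force a decrease of the potential. -/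
theorem sq_le_two_mul_drop (t : ℕ) {d e : G.Dart} (h : d.snd = e.snd) :
    ((W.we t d : ℤ) - W.we t e) ^ 2 - 1 ≤ 2 * W.drop t d.snd := by
  by_cases hde : d = e
  · subst hde
    have := W.drop_nonneg t d.snd
    simp only [sub_self]
    linarith
  rw [drop_eq]
  set q : ℤ := ((W.wv (t + 1) d.snd / G.degree d.snd : ℕ) : ℤ)
  have hsub : ({d, e} : Finset G.Dart) ⊆ inArcs G d.snd := by
    intro x hx
    rcases Finset.mem_insert.mp hx with rfl | hx
    · simp [inArcs]
    · rw [Finset.mem_singleton.mp hx]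
      simp [inArcs, h]
  have := Finset.sum_le_sum_of_subset_of_nonneg
    (f := fun x => ((W.we t x : ℤ) - q) * ((W.we t x : ℤ) - q - 1)) hsub
    fun x _ _ => mul_sub_one_nonneg _
  rw [Finset.sum_pair hde] at this
  nlinarith [sq_nonneg ((W.we t d : ℤ) + W.we t e - 2 * q - 1)]

/-- A large difference between two arc loads forces a decrease of the potential. -/
theorem sq_le_mul_rfPot_sub (hconn : G.Connected) (hnb : ¬ G.Colorable 2) (t : ℕ)
    (d e : G.Dart) (h : W.we t e + 10 * G.diam < W.we t d) :
    ((W.we t d : ℤ) - W.we t e) ^ 2 ≤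
      4 * G.diam * ((rfPot G W t : ℤ) - rfPot G W (t + 1)) := by
  obtain ⟨l, hl, p, hp0, hpl, hadj, hinj⟩ := exists_even_seq hconn hnb d.fst e.fst
  set w : V → ℤ := fun v => ((W.wv t v / G.degree v : ℕ) : ℤ)
  have hw : ∀ x : G.Dart, w x.fst ≤ W.we t x ∧ (W.we t x : ℤ) ≤ w x.fst + 1 := by
    intro x
    simp only [w]
    rcases W.we_eq_or t x with h | h <;> omega
  have hstep : ∀ i, ∃ δ : ℤ, i < l →
      w (p (2 * i)) - w (p (2 * (i + 1))) ≤ δ + 1 ∧ δ ^ 2 - 1 ≤ 2 * W.drop t (p (2 * i + 1)) := by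
    intro i
    by_cases hi : i < l
    · let a : G.Dart := ⟨(p (2 * i), p (2 * i + 1)), hadj _ (by omega)⟩
      let b : G.Dart := ⟨(p (2 * (i + 1)), p (2 * i + 1)), (hadj (2 * i + 1) (by omega)).symm⟩
      refine ⟨(W.we t a : ℤ) - W.we t b, fun _ => ⟨?_, W.sq_le_two_mul_drop t (d := a) (e := b) rfl⟩⟩
      have ha : w (p (2 * i)) ≤ W.we t a := (hw a).1
      have hb : (W.we t b : ℤ) ≤ w (p (2 * (i + 1))) + 1 := (hw b).2
      linarith
    · exact ⟨0, fun h => absurd h hi⟩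
  choose δ hδ using hstep
  have htel : w d.fst - w e.fst ≤ ∑ i ∈ Finset.range l, δ i + l := by
    have h1 := Finset.sum_range_sub' (fun i => w (p (2 * i))) l
    simp only [mul_zero, hp0, hpl] at h1
    rw [← h1]
    calc _ ≤ ∑ i ∈ Finset.range l, (δ i + 1) :=
          Finset.sum_le_sum fun i hi => (hδ i (Finset.mem_range.mp hi)).1
      _ = _ := by simp [Finset.sum_add_distrib]
  have hdrop : ∑ i ∈ Finset.range l, (δ i) ^ 2 - l ≤
      2 * ((rfPot G W t : ℤ) - rfPot G W (t + 1)) := by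
    have hle : ∑ i ∈ Finset.range l, W.drop t (p (2 * i + 1)) ≤ ∑ v, W.drop t v := by
      rw [← Finset.sum_image (s := Finset.range l) (g := fun i => p (2 * i + 1))
        (f := fun v => W.drop t v) fun i hi j hj hij =>
          hinj i (by simpa using hi) j (by simpa using hj) hij]
      exact Finset.sum_le_sum_of_subset_of_nonneg (Finset.subset_univ _)
        fun v _ _ => W.drop_nonneg t v
    rw [W.sum_drop] at hle
    calc _ = ∑ i ∈ Finset.range l, ((δ i) ^ 2 - 1) := by simp
      _ ≤ ∑ i ∈ Finset.range l, 2 * W.drop t (p (2 * i + 1)) :=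
          Finset.sum_le_sum fun i hi => (hδ i (Finset.mem_range.mp hi)).2
      _ ≤ _ := by rw [← Finset.mul_sum]; linarith
  have hcs := sq_sum_le_card_mul_sum_sq (s := Finset.range l) (f := δ)
  rw [Finset.card_range] at hcs
  have hD : 1 ≤ G.diam := one_le_diam_of_dart hconn d
  set S := ∑ i ∈ Finset.range l, δ i
  set S2 := ∑ i ∈ Finset.range l, (δ i) ^ 2
  have hS2 : 0 ≤ S2 := Finset.sum_nonneg fun i _ => sq_nonneg _
  have hd := (hw d).2
  have he := (hw e).1
  generalize (rfPot G W t : ℤ) - rfPot G W (t + 1) = R at *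
  obtain ⟨x, hx⟩ : ∃ x : ℤ, x = (W.we t d : ℤ) - W.we t e := ⟨_, rfl⟩
  rw [← hx]
  have hlD : (l : ℤ) ≤ G.diam := by exact_mod_cast hl
  have hD' : (1 : ℤ) ≤ G.diam := by exact_mod_cast hD
  have hxD : 10 * (G.diam : ℤ) < x := by omega
  generalize (G.diam : ℤ) = D at *
  have hSx : 4 * x ≤ 5 * S := by linarith
  have hSq : 16 * x ^ 2 ≤ 25 * S ^ 2 := by nlinarith
  have h1 : S ^ 2 ≤ D * S2 := hcs.trans (mul_le_mul_of_nonneg_right hlD hS2)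
  have h2 : D * (S2 - l) ≤ D * (2 * R) := mul_le_mul_of_nonneg_left hdrop (by linarith)
  have h3 : D * l ≤ D * D := mul_le_mul_of_nonneg_left hlD (by linarith)
  have h4 : 100 * (D * D) ≤ x ^ 2 := by nlinarith
  nlinarith

end RoundFairProcess

variable (G)

/-- For a round-fair process with `k ≥ 2` tokens on a finite connected
non-bipartite graph with `m` edges and diameter `D`, at every time `T ≥ 16·m·D·ln k` the
discrepancy over arcs is at most `10D`. -/
theorem discrepancy_small_after_convergence (hconn : G.Connected) (hnb : ¬ G.Colorable 2)
    (W : RoundFairProcess G) (k : ℕ) (hk2 : 2 ≤ k)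
    (hk : (∑ d : G.Dart, W.we 0 d) = k) (T : ℕ)
    (hT : 16 * (G.edgeFinset.card : ℝ) * (G.diam : ℝ) * Real.log (k : ℝ) ≤ (T : ℝ)) :
    disc G W T ≤ 10 * G.diam := by
  by_contra hcon
  have hgap : ∀ t ≤ T, ∃ d e : G.Dart, W.we t e + 10 * G.diam < W.we t d ∧
      ∀ x, W.we t e ≤ W.we t x ∧ W.we t x ≤ W.we t d := by
    intro t ht
    obtain ⟨⟨d₀, -⟩, -⟩ : ∃ p : G.Dart × G.Dart,
        10 * G.diam < W.we T p.1 - W.we T p.2 := by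
      by_contra! h
      exact hcon (Finset.sup_le fun p _ => h p)
    have : Nonempty G.Dart := ⟨d₀⟩
    obtain ⟨d, hd⟩ := Finite.exists_max (W.we t)
    obtain ⟨e, he⟩ := Finite.exists_min (W.we t)
    refine ⟨d, e, ?_, fun x => ⟨he x, hd x⟩⟩
    by_contra! hle
    refine hcon (Finset.sup_le fun p _ => ?_)
    have hb := W.bounds_of_le ht (fun x => ⟨he x, hd x⟩)
    have h1 := (hb p.1).2
    have h2 := (hb p.2).1
    omega
  have hcard : (Fintype.card G.Dart : ℝ) = 2 * (G.edgeFinset.card : ℝ) := by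
    exact_mod_cast G.dart_card_eq_twice_card_edges
  have hsum : ∀ t, ∑ d, (W.we t d : ℝ) = k := fun t => by
    exact_mod_cast (W.sum_we t).trans hk
  obtain ⟨d₀, e₀, h₀, -⟩ := hgap T le_rfl
  have hD : (1 : ℝ) ≤ G.diam := by
    exact_mod_cast one_le_diam_of_dart hconn d₀
  have hm : (1 : ℝ) ≤ G.edgeFinset.card := by
    have : 0 < G.edgeFinset.card := by
      have h1 := G.dart_card_eq_twice_card_edges
      have h2 : 0 < Fintype.card G.Dart := Fintype.card_pos_iff.mpr ⟨d₀⟩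
      omega
    exact_mod_cast this
  set m : ℝ := (G.edgeFinset.card : ℝ)
  set D : ℝ := (G.diam : ℝ) with hDdef
  set c : ℝ := k / (2 * m) with hc
  have hcm : c * (2 * m) = k := div_mul_cancel₀ _ (by positivity)
  have hshift : ∀ (t : ℕ) (a : ℝ), ∑ d, ((W.we t d : ℝ) - a) ^ 2 =
      rfPot G W t - 2 * a * k + 2 * m * a ^ 2 := by
    intro t a
    rw [← hsum t, ← hcard, rfPot, Finset.mul_sum, ← nsmul_eq_mul, ← Finset.card_univ,
      ← Finset.sum_const]
    push_cast
    rw [← Finset.sum_sub_distrib, ← Finset.sum_add_distrib]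
    exact Finset.sum_congr rfl fun d _ => by ring
  set Ψ : ℕ → ℝ := fun t => ∑ d, ((W.we t d : ℝ) - c) ^ 2 with hΨ
  have hdec : ∀ t ≤ T, Ψ (t + 1) ≤ (1 - 1 / (8 * m * D)) * Ψ t := by
    intro t ht
    obtain ⟨d, e, hde, hb⟩ := hgap t ht
    have h1 : ((W.we t d : ℝ) - W.we t e) ^ 2 ≤
        4 * D * ((rfPot G W t : ℝ) - rfPot G W (t + 1)) := by
      have h := W.sq_le_mul_rfPot_sub hconn hnb t d e hde
      rw [← @Int.cast_le ℝ] at h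
      push_cast at h
      exact h
    have h2 : Ψ t ≤ 2 * m * ((W.we t d : ℝ) - W.we t e) ^ 2 := by
      have h3 : ∑ x, ((W.we t x : ℝ) - W.we t e) ^ 2 ≤
          2 * m * ((W.we t d : ℝ) - W.we t e) ^ 2 := by
        rw [← hcard, ← nsmul_eq_mul, ← Finset.card_univ]
        refine Finset.sum_le_card_nsmul _ _ _ fun x _ => ?_
        have h4 : (W.we t e : ℝ) ≤ W.we t x := by exact_mod_cast (hb x).1
        have h5 : (W.we t x : ℝ) ≤ W.we t d := by exact_mod_cast (hb x).2
        exact pow_le_pow_left₀ (by linarith) (by linarith) 2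
      refine le_trans ?_ h3
      simp only [hΨ]
      rw [hshift, hshift, ← hcm]
      nlinarith [mul_nonneg (zero_le_one.trans hm) (sq_nonneg (c - W.we t e))]
    have h6 : Ψ t - Ψ (t + 1) = (rfPot G W t : ℝ) - rfPot G W (t + 1) := by
      simp only [hΨ]
      rw [hshift, hshift]
      ring
    have h7 : Ψ t ≤ (Ψ t - Ψ (t + 1)) * (8 * m * D) := by
      rw [h6]
      nlinarith
    have h8 := (div_le_iff₀ (by positivity : 0 < 8 * m * D)).mpr h7
    calc Ψ (t + 1) ≤ Ψ t - Ψ t / (8 * m * D) := by linarith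
      _ = _ := by ring
  have hρ : 0 ≤ 1 - 1 / (8 * m * D) := by
    rw [sub_nonneg, div_le_one (by positivity)]
    nlinarith
  have hpow : ∀ t ≤ T, Ψ t ≤ (1 - 1 / (8 * m * D)) ^ t * Ψ 0 := by
    intro t
    induction t with
    | zero => simp
    | succ t ih =>
      intro ht
      refine (hdec t (by omega)).trans ?_
      calc _ ≤ _ := mul_le_mul_of_nonneg_left (ih (by omega)) hρ
        _ = _ := by ring
  have hk0 : (0 : ℝ) < k := by exact_mod_cast (by omega : 0 < k)
  have hΨ0 : Ψ 0 ≤ (k : ℝ) ^ 2 := by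
    have h1 : (rfPot G W 0 : ℝ) ≤ (k : ℝ) ^ 2 := by
      rw [← hsum 0, rfPot]
      push_cast
      exact Finset.sum_sq_le_sq_sum_of_nonneg fun d _ => Nat.cast_nonneg _
    simp only [hΨ]
    rw [hshift, ← hcm]
    rw [← hcm] at h1
    nlinarith [mul_nonneg (zero_le_one.trans hm) (sq_nonneg c)]
  have hexp : (1 - 1 / (8 * m * D)) ^ T * (k : ℝ) ^ 2 ≤ 1 := by
    have h1 : (1 - 1 / (8 * m * D)) ^ T ≤ Real.exp (-(2 * Real.log k)) := by
      calc (1 - 1 / (8 * m * D)) ^ T ≤ Real.exp (-(1 / (8 * m * D))) ^ T :=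
            pow_le_pow_left₀ hρ (Real.one_sub_le_exp_neg _) T
        _ = Real.exp (-(T / (8 * m * D))) := by
            rw [← Real.exp_nat_mul]
            congr 1
            ring
        _ ≤ _ := by
            rw [Real.exp_le_exp, neg_le_neg_iff, le_div_iff₀ (by positivity)]
            linarith
    have h2 : Real.exp (-(2 * Real.log k)) * (k : ℝ) ^ 2 = 1 := by
      rw [Real.exp_neg, two_mul, Real.exp_add, Real.exp_log hk0]
      field_simp
    exact (mul_le_mul_of_nonneg_right h1 (by positivity)).trans h2.le
  have hupper : Ψ T ≤ 1 :=
    ((hpow T le_rfl).trans (mul_le_mul_of_nonneg_left hΨ0 (pow_nonneg hρ T))).trans hexp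
  have hne : d₀ ≠ e₀ := by
    rintro rfl
    omega
  have hlower := Finset.sum_le_sum_of_subset_of_nonneg
    (f := fun d => ((W.we T d : ℝ) - c) ^ 2) (Finset.subset_univ {d₀, e₀})
    fun x _ _ => sq_nonneg _
  rw [Finset.sum_pair hne] at hlower
  have hgapR : (W.we T e₀ : ℝ) + 10 * D < W.we T d₀ := by
    rw [hDdef]
    exact_mod_cast h₀
  nlinarith [sq_nonneg ((W.we T d₀ : ℝ) - c + (W.we T e₀ - c)), hlower.trans hupper]

end RotorRouter
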